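/- Every minimal counterexample has minimum degree at least 5. -/

import Mathlib

open SimpleGraph

variable {V : Type}

/-- The involution of the darts of a graph reversing each dart. -/
def dartRev (G : SimpleGraph V) : Equiv.Perm G.Dart :=
  Function.Involutive.toPerm SimpleGraph.Dart.symm SimpleGraph.Dart.symm_involutive

/-- The face permutation of a rotation system `σ`: it sends a dart `(u,v)` to `σ (v,u)`. -/
def facePerm {G : SimpleGraph V} (σ : Equiv.Perm G.Dart) : Equiv.Perm G.Dart :=
  (dartRev G).trans σ

/-- The setoid on `α` whose classes are the orbits (cycles) of a permutation of `α`. -/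
def orbitSetoid {α : Type*} (f : Equiv.Perm α) : Setoid α :=
  ⟨f.SameCycle, ⟨fun x => Equiv.Perm.SameCycle.refl f x, fun h => h.symm, fun h h' => h.trans h'⟩⟩

/-- The number of faces of a rotation system: the number of orbits of the face permutation. -/
noncomputable def numFaces {G : SimpleGraph V} (σ : Equiv.Perm G.Dart) : ℕ :=
  Nat.card (Quotient (orbitSetoid (facePerm σ)))

/-- The number of darts in the face (orbit of the face permutation) containing the dart `d`. -/
noncomputable def faceSize {G : SimpleGraph V} (σ : Equiv.Perm G.Dart) (d : G.Dart) : ℕ :=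
  Nat.card {e : G.Dart // (facePerm σ).SameCycle d e}

/-- `σ` is a rotation system on `G`: every dart and its image share their first vertex, and
the `σ`-orbit of every dart consists of all darts sharing its first vertex. -/
structure IsRotationSystem (G : SimpleGraph V) (σ : Equiv.Perm G.Dart) : Prop where
  fst_eq : ∀ d : G.Dart, (σ d).toProd.1 = d.toProd.1
  orbit_eq : ∀ d e : G.Dart, d.toProd.1 = e.toProd.1 → σ.SameCycle d e

/-- The degree of a vertex. -/
noncomputable def deg (G : SimpleGraph V) (v : V) : ℕ := Nat.card (G.neighborSet v)

/-- A plane triangulation: a finite connected simple graph on at least 4 vertices equipped with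
a rotation system satisfying Euler's formula `|V| - |E| + F = 2` in which every face consists of
exactly 3 darts. -/
structure IsPlaneTriangulation [Fintype V] (G : SimpleGraph V) (σ : Equiv.Perm G.Dart) :
    Prop where
  connected : G.Connected
  four_le_card : 4 ≤ Fintype.card V
  rot : IsRotationSystem G σ
  euler : Fintype.card V + numFaces σ = Nat.card G.edgeSet + 2
  face_size_eq : ∀ d : G.Dart, faceSize σ d = 3

/-- A proper 5-coloring (colors `0,...,4` standing for `1,...,5`). -/
def Proper5 (G : SimpleGraph V) (c : V → Fin 5) : Prop :=
  ∀ ⦃u w : V⦄, G.Adj u w → c u ≠ c w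

/-- A finite simple graph is planar if it is isomorphic to a subgraph of a plane triangulation. -/
def IsPlanar [Fintype V] (G : SimpleGraph V) : Prop :=
  ∃ (W : Type) (iW : Fintype W) (T : SimpleGraph W) (σ : Equiv.Perm T.Dart),
    @IsPlaneTriangulation W iW T σ ∧ ∃ f : G →g T, Function.Injective f

/-- `w` is the neighbor of `v` following `u` in the cyclic (counterclockwise) order
around `v` given by the rotation system `σ`. -/
def NextNbr {G : SimpleGraph V} (σ : Equiv.Perm G.Dart) (v u w : V) : Prop :=
  ∃ h : G.Adj v u, (σ ⟨(v, u), h⟩).toProd.2 = w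

/-- A minimal counterexample: a plane triangulation admitting no proper 5-coloring with some
color class of size at most `|V|/6`, while every planar graph on fewer vertices admits one. -/
def IsMinimalCounterexample [Fintype V] (G : SimpleGraph V) (σ : Equiv.Perm G.Dart) : Prop :=
  IsPlaneTriangulation G σ ∧
  (¬ ∃ c : V → Fin 5, Proper5 G c ∧
      ∃ k : Fin 5, 6 * Nat.card {v : V | c v = k} ≤ Fintype.card V) ∧
  (∀ (W : Type) [Fintype W] (H : SimpleGraph W), IsPlanar H →
      Fintype.card W < Fintype.card V →
      ∃ c : W → Fin 5, Proper5 H c ∧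
        ∃ k : Fin 5, 6 * Nat.card {w : W | c w = k} ≤ Fintype.card W)

theorem pi_add_self {α : Type*} (f : α → ZMod 2) : f + f = 0 := by
  funext a
  exact CharTwo.add_self_eq_zero _

open Classical in
/-- Mod 2 boundary of an edge chain, as a vertex chain. -/
noncomputable def bdOne [Fintype V] (G : SimpleGraph V) :
    (G.edgeSet → ZMod 2) →ₗ[ZMod 2] (V → ZMod 2) where
  toFun x := fun v => ∑ d : G.Dart, if d.toProd.1 = v then x ⟨d.edge, d.edge_mem⟩ else 0
  map_add' x y := by
    funext v
    simp only [Pi.add_apply, ← Finset.sum_add_distrib]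
    refine Finset.sum_congr rfl fun d _ => ?_
    split_ifs <;> simp
  map_smul' a x := by
    funext v
    simp only [Pi.smul_apply, smul_eq_mul, RingHom.id_apply, Finset.mul_sum]
    refine Finset.sum_congr rfl fun d _ => ?_
    split_ifs <;> simp

open Classical in
theorem bdOne_single [Fintype V] (G : SimpleGraph V) (d : G.Dart) :
    bdOne G (Pi.single ⟨d.edge, d.edge_mem⟩ 1) =
      Pi.single d.toProd.1 1 + Pi.single d.toProd.2 1 := by
  funext v
  have h1 : bdOne G (Pi.single ⟨d.edge, d.edge_mem⟩ 1) v =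
      ∑ e ∈ ({d, d.symm} : Finset G.Dart), if e.toProd.1 = v then (1 : ZMod 2) else 0 := by
    change (∑ e : G.Dart, if e.toProd.1 = v then
      (Pi.single ⟨d.edge, d.edge_mem⟩ 1 : G.edgeSet → ZMod 2) ⟨e.edge, e.edge_mem⟩ else 0) = _
    symm
    rw [← Finset.sum_subset (Finset.subset_univ ({d, d.symm} : Finset G.Dart))]
    · refine Finset.sum_congr rfl fun e he => ?_
      have he' : e.edge = d.edge := by
        rw [SimpleGraph.dart_edge_eq_iff]
        simpa using he
      simp [Pi.single_apply, he']
    · intro e _ he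
      have he' : e.edge ≠ d.edge := by
        rw [Ne, SimpleGraph.dart_edge_eq_iff]
        simpa using he
      simp [Pi.single_apply, he']
  rw [h1, Finset.sum_pair d.symm_ne.symm]
  simp [Pi.single_apply, eq_comm]

open Classical in
theorem path_chain [Fintype V] (G : SimpleGraph V) (A : Set V) (a b : V)
    (h : Relation.ReflTransGen (fun p q => G.Adj p q ∧ p ∈ A ∧ q ∈ A) a b) :
    ∃ x : G.edgeSet → ZMod 2, bdOne G x = Pi.single a 1 + Pi.single b 1 ∧
      ∀ d : G.Dart, (d.toProd.1 ∉ A ∨ d.toProd.2 ∉ A) → x ⟨d.edge, d.edge_mem⟩ = 0 := by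
  induction h with
  | refl => exact ⟨0, by rw [pi_add_self, map_zero], by simp⟩
  | @tail p q _ hpq ih =>
    obtain ⟨x, hx, hx0⟩ := ih
    obtain ⟨hadj, hp, hq⟩ := hpq
    let d : G.Dart := ⟨(p, q), hadj⟩
    refine ⟨x + Pi.single ⟨d.edge, d.edge_mem⟩ 1, ?_, ?_⟩
    · rw [map_add, hx, bdOne_single]
      have : (Pi.single p 1 + Pi.single p 1 : V → ZMod 2) = 0 := pi_add_self _
      change Pi.single a 1 + Pi.single p 1 + (Pi.single p 1 + Pi.single q 1) = _
      calc _ = Pi.single a 1 + (Pi.single p 1 + Pi.single p 1) + Pi.single q 1 := by abel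
        _ = _ := by rw [this, add_zero]
    · intro e he
      have hne : e.edge ≠ d.edge := by
        rw [Ne, SimpleGraph.dart_edge_eq_iff]
        rintro (rfl | rfl)
        · rcases he with he | he
          · exact he hp
          · exact he hq
        · rcases he with he | he
          · exact he hq
          · exact he hp
      rw [Pi.add_apply, hx0 e he, Pi.single_apply, if_neg (by simpa using hne), add_zero]

theorem finrank_bdOne [Fintype V] (G : SimpleGraph V) (hc : G.Connected) :
    Fintype.card V ≤ Module.finrank (ZMod 2) (LinearMap.range (bdOne G)) + 1 := by
  classical
  obtain ⟨r⟩ := hc.nonempty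
  have htop : LinearMap.range (bdOne G) ⊔
      Submodule.span (ZMod 2) {(Pi.single r 1 : V → ZMod 2)} = ⊤ := by
    rw [eq_top_iff, ← (Pi.basisFun (ZMod 2) V).span_eq, Submodule.span_le]
    rintro _ ⟨v, rfl⟩
    rw [Pi.basisFun_apply]
    have hr : Relation.ReflTransGen (fun p q => G.Adj p q ∧ p ∈ Set.univ ∧ q ∈ Set.univ) v r := by
      have := (SimpleGraph.reachable_iff_reflTransGen v r).1 (hc.preconnected v r)
      exact Relation.ReflTransGen.mono (fun a b h => ⟨h, trivial, trivial⟩) _ _ this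
    obtain ⟨x, hx, -⟩ := path_chain G Set.univ v r hr
    have h2 : (Pi.single v 1 : V → ZMod 2) = bdOne G x + Pi.single r 1 := by
      rw [hx, add_assoc, pi_add_self, add_zero]
    rw [h2]
    exact Submodule.add_mem_sup ⟨x, rfl⟩ (Submodule.mem_span_singleton_self _)
  have h1 := Submodule.finrank_add_le_finrank_add_finrank (LinearMap.range (bdOne G))
    (Submodule.span (ZMod 2) {(Pi.single r 1 : V → ZMod 2)})
  rw [htop, finrank_top, Module.finrank_fintype_fun_eq_card] at h1
  have h2 := finrank_span_le_card (R := ZMod 2) ({(Pi.single r 1 : V → ZMod 2)} : Set _)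
  simp at h2
  omega

/-- A chosen dart of an edge. -/
theorem exists_dart_of_edge (G : SimpleGraph V) (e : G.edgeSet) : ∃ d : G.Dart, d.edge = e.1 := by
  obtain ⟨e, he⟩ := e
  induction e using Sym2.ind with
  | _ a b => exact ⟨⟨(a, b), he⟩, rfl⟩

/-- Mod 2 boundary of a face chain, as an edge chain. -/
noncomputable def bdTwo (G : SimpleGraph V) (σ : Equiv.Perm G.Dart) :
    (Quotient (orbitSetoid (facePerm σ)) → ZMod 2) →ₗ[ZMod 2] (G.edgeSet → ZMod 2) where
  toFun s := fun e =>
    s (Quotient.mk _ (exists_dart_of_edge G e).choose) +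
      s (Quotient.mk _ (exists_dart_of_edge G e).choose.symm)
  map_add' x y := by
    funext e
    simp only [Pi.add_apply]
    ring
  map_smul' a x := by
    funext e
    simp only [Pi.smul_apply, smul_eq_mul, RingHom.id_apply]
    ring

theorem bdTwo_dart (G : SimpleGraph V) (σ : Equiv.Perm G.Dart)
    (s : Quotient (orbitSetoid (facePerm σ)) → ZMod 2) (d : G.Dart) :
    bdTwo G σ s ⟨d.edge, d.edge_mem⟩ = s (Quotient.mk _ d) + s (Quotient.mk _ d.symm) := by
  have h := (exists_dart_of_edge G ⟨d.edge, d.edge_mem⟩).choose_spec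
  change s (Quotient.mk _ (exists_dart_of_edge G ⟨d.edge, d.edge_mem⟩).choose) +
      s (Quotient.mk _ (exists_dart_of_edge G ⟨d.edge, d.edge_mem⟩).choose.symm) = _
  rcases (SimpleGraph.dart_edge_eq_iff _ _).1 h with h | h
  · rw [h]
  · rw [h, SimpleGraph.Dart.symm_symm, add_comm]

theorem mk_symm (G : SimpleGraph V) (σ : Equiv.Perm G.Dart) (d : G.Dart) :
    (Quotient.mk (orbitSetoid (facePerm σ)) d.symm) = Quotient.mk _ (σ d) := by
  apply Quotient.sound
  change (facePerm σ).SameCycle d.symm (σ d)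
  have h : σ d = facePerm σ d.symm := by
    change σ d = σ d.symm.symm
    rw [SimpleGraph.Dart.symm_symm]
  rw [h]
  exact Equiv.Perm.sameCycle_apply_right.2 (Equiv.Perm.SameCycle.refl _ _)

theorem bd_comp [Fintype V] (G : SimpleGraph V) (σ : Equiv.Perm G.Dart)
    (hσ : IsRotationSystem G σ) (s : Quotient (orbitSetoid (facePerm σ)) → ZMod 2) :
    bdOne G (bdTwo G σ s) = 0 := by
  classical
  funext v
  change (∑ d : G.Dart, if d.toProd.1 = v then
    bdTwo G σ s ⟨d.edge, d.edge_mem⟩ else 0) = 0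
  have h1 : ∀ d : G.Dart, (if d.toProd.1 = v then bdTwo G σ s ⟨d.edge, d.edge_mem⟩ else 0) =
      (if d.toProd.1 = v then s (Quotient.mk _ d) else 0) +
      (if (σ d).toProd.1 = v then s (Quotient.mk _ (σ d)) else 0) := by
    intro d
    rw [bdTwo_dart, mk_symm, hσ.fst_eq]
    split_ifs <;> simp
  have h2 := Equiv.sum_comp σ
    (fun d : G.Dart => if d.toProd.1 = v then s (Quotient.mk (orbitSetoid (facePerm σ)) d) else 0)
  have h3 : (∑ d : G.Dart, if d.toProd.1 = v then bdTwo G σ s ⟨d.edge, d.edge_mem⟩ else 0) =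
      ∑ d : G.Dart, ((if d.toProd.1 = v then s (Quotient.mk _ d) else 0) +
      (if (σ d).toProd.1 = v then s (Quotient.mk _ (σ d)) else 0)) :=
    Finset.sum_congr rfl fun d _ => h1 d
  calc _ = _ := by convert h3
    _ = _ := by rw [Finset.sum_add_distrib, h2, CharTwo.add_self_eq_zero]

/-- A function on darts invariant along rotation at `b`. -/
theorem const_of_sameCycle {α β : Type*} (f : Equiv.Perm α) (s : α → β) (P : α → Prop)
    (hP : ∀ a, P a → P (f a)) [Finite α]
    (h : ∀ a, P a → s (f a) = s a) (a b : α) (ha : P a) (hab : f.SameCycle a b) : s b = s a := by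
  obtain ⟨n, -, rfl⟩ := hab.exists_nat_pow_eq
  have key : ∀ n : ℕ, P ((f ^ n) a) ∧ s ((f ^ n) a) = s a := by
    intro n
    induction n with
    | zero => exact ⟨ha, rfl⟩
    | succ n ih =>
      rw [pow_succ', Equiv.Perm.mul_apply]
      exact ⟨hP _ ih.1, (h _ ih.1).trans ih.2⟩
  exact (key n).2

theorem finrank_bdTwo_ker [Fintype V] (G : SimpleGraph V) (σ : Equiv.Perm G.Dart)
    (hσ : IsRotationSystem G σ) (hc : G.Connected) :
    Module.finrank (ZMod 2) (LinearMap.ker (bdTwo G σ)) ≤ 1 := by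
  classical
  have hle : LinearMap.ker (bdTwo G σ) ≤ Submodule.span (ZMod 2)
      {(1 : Quotient (orbitSetoid (facePerm σ)) → ZMod 2)} := by
    intro s hs
    have hsym : ∀ d : G.Dart, s (Quotient.mk _ d.symm) = s (Quotient.mk _ d) := by
      intro d
      have h := bdTwo_dart G σ s d
      rw [LinearMap.mem_ker.1 hs] at h
      exact (CharTwo.add_eq_zero.1 h.symm).symm
    have hrot : ∀ d e : G.Dart, d.toProd.1 = e.toProd.1 →
        s (Quotient.mk _ e) = s (Quotient.mk _ d) := by
      intro d e hde
      refine const_of_sameCycle σ (fun d => s (Quotient.mk _ d)) (fun _ => True)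
        (fun _ _ => trivial) (fun a _ => ?_) d e trivial (hσ.orbit_eq d e hde)
      change s (Quotient.mk _ (σ a)) = s (Quotient.mk _ a)
      rw [← mk_symm, hsym]
    have hall : ∀ d e : G.Dart, s (Quotient.mk _ e) = s (Quotient.mk _ d) := by
      intro d
      have key : ∀ b, Relation.ReflTransGen G.Adj d.toProd.1 b → ∀ e : G.Dart, e.toProd.1 = b →
          s (Quotient.mk _ e) = s (Quotient.mk _ d) := by
        intro b hb
        induction hb with
        | refl => exact fun e he => hrot d e he.symm
        | @tail p q _ hpq ih =>
          intro e he
          rw [← ih ⟨(p, q), hpq⟩ rfl, ← hsym ⟨(p, q), hpq⟩]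
          exact hrot _ _ he.symm
      exact fun e => key _ ((SimpleGraph.reachable_iff_reflTransGen _ _).1
        (hc.preconnected _ _)) e rfl
    rw [Submodule.mem_span_singleton]
    by_cases hne : Nonempty G.Dart
    · obtain ⟨d⟩ := hne
      refine ⟨s (Quotient.mk _ d), ?_⟩
      funext q
      induction q using Quotient.ind with
      | _ e => simp [hall d e]
    · refine ⟨0, ?_⟩
      funext q
      induction q using Quotient.ind with
      | _ e => exact (hne ⟨e⟩).elim
  refine (Submodule.finrank_mono hle).trans ?_
  have h2 := finrank_span_le_card (R := ZMod 2)
    ({(1 : Quotient (orbitSetoid (facePerm σ)) → ZMod 2)} : Set _)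
  simpa using h2

/-- On a plane map every mod 2 edge cycle is a boundary. -/
theorem cycle_is_boundary [Fintype V] (G : SimpleGraph V) (σ : Equiv.Perm G.Dart)
    (hσ : IsPlaneTriangulation G σ) (x : G.edgeSet → ZMod 2) (hx : bdOne G x = 0) :
    ∃ s, bdTwo G σ s = x := by
  classical
  haveI : Fintype (Quotient (orbitSetoid (facePerm σ))) := Fintype.ofFinite _
  have hle : LinearMap.range (bdTwo G σ) ≤ LinearMap.ker (bdOne G) := by
    rintro _ ⟨s, rfl⟩
    exact bd_comp G σ hσ.rot s
  have h1 := finrank_bdOne G hσ.connected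
  have h2 := finrank_bdTwo_ker G σ hσ.rot hσ.connected
  have h3 := LinearMap.finrank_range_add_finrank_ker (bdOne G)
  have h4 := LinearMap.finrank_range_add_finrank_ker (bdTwo G σ)
  rw [Module.finrank_fintype_fun_eq_card] at h3 h4
  have h5 := hσ.euler
  rw [numFaces, Nat.card_eq_fintype_card, Nat.card_eq_fintype_card] at h5
  have h6 : LinearMap.range (bdTwo G σ) = LinearMap.ker (bdOne G) := by
    apply Submodule.eq_of_le_of_finrank_le hle
    omega
  have h7 : x ∈ LinearMap.range (bdTwo G σ) := by rw [h6]; exact hx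
  exact h7

/-- Discrete Jordan curve theorem around a vertex of degree four. -/
theorem jordan_four [Fintype V] (G : SimpleGraph V) (σ : Equiv.Perm G.Dart)
    (hσ : IsPlaneTriangulation G σ) (v : V) (d1 d2 d3 d4 : G.Dart)
    (hv1 : d1.toProd.1 = v) (h12 : σ d1 = d2) (h23 : σ d2 = d3) (h34 : σ d3 = d4)
    (h41 : σ d4 = d1) (h13 : d1 ≠ d3) (A B : Set V) (hAB : ∀ w, w ∈ A → w ∉ B) (hvA : v ∉ A)
    (hvB : v ∉ B) (h1A : d1.toProd.2 ∈ A) (h3A : d3.toProd.2 ∈ A)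
    (h2B : d2.toProd.2 ∈ B) (h4B : d4.toProd.2 ∈ B)
    (hA : Relation.ReflTransGen (fun p q => G.Adj p q ∧ p ∈ A ∧ q ∈ A) d1.toProd.2 d3.toProd.2)
    (hB : Relation.ReflTransGen (fun p q => G.Adj p q ∧ p ∈ B ∧ q ∈ B) d2.toProd.2 d4.toProd.2) :
    False := by
  classical
  have hv2 : d2.toProd.1 = v := by rw [← h12, hσ.rot.fst_eq, hv1]
  have hv3 : d3.toProd.1 = v := by rw [← h23, hσ.rot.fst_eq, hv2]
  have hv4 : d4.toProd.1 = v := by rw [← h34, hσ.rot.fst_eq, hv3]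
  obtain ⟨x0, hx0, hx0A⟩ := path_chain G A _ _ hA
  let e1 : G.edgeSet := ⟨d1.edge, d1.edge_mem⟩
  let e3 : G.edgeSet := ⟨d3.edge, d3.edge_mem⟩
  let x : G.edgeSet → ZMod 2 := x0 + (Pi.single e1 1 + Pi.single e3 1)
  have hx : bdOne G x = 0 := by
    change bdOne G (x0 + (Pi.single e1 1 + Pi.single e3 1)) = 0
    rw [map_add, map_add, hx0, bdOne_single, bdOne_single, hv1, hv3]
    have h0 : ∀ f g : V → ZMod 2, f = g → f + g = 0 := fun f g h => by rw [h, pi_add_self]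
    apply h0
    have : (Pi.single v 1 + Pi.single v 1 : V → ZMod 2) = 0 := pi_add_self _
    calc _ = (Pi.single v 1 + Pi.single v 1 : V → ZMod 2) +
          (Pi.single d1.toProd.2 1 + Pi.single d3.toProd.2 1) := by rw [this, zero_add]
      _ = _ := by abel
  obtain ⟨s, hs⟩ := cycle_is_boundary G σ hσ x hx
  have hstep : ∀ d : G.Dart, s (Quotient.mk _ (σ d)) =
      s (Quotient.mk _ d) + x ⟨d.edge, d.edge_mem⟩ := by
    intro d
    rw [← hs, bdTwo_dart, mk_symm, ← add_assoc, CharTwo.add_self_eq_zero, zero_add]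
  have hxval : ∀ d : G.Dart, x ⟨d.edge, d.edge_mem⟩ = x0 ⟨d.edge, d.edge_mem⟩ +
      ((if d.edge = d1.edge then 1 else 0) + (if d.edge = d3.edge then 1 else 0)) := by
    intro d
    change x0 _ + ((Pi.single e1 1 : G.edgeSet → ZMod 2) _ + (Pi.single e3 1 : G.edgeSet → ZMod 2) _) = _
    simp [Pi.single_apply, e1, e3]
  have hne13 : d1.edge ≠ d3.edge := by
    rw [Ne, SimpleGraph.dart_edge_eq_iff]
    rintro (h | h)
    · exact h13 h
    · apply hvA
      rw [h] at h1A
      rw [← hv3]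
      exact h1A
  have hx1 : x ⟨d1.edge, d1.edge_mem⟩ = 1 := by
    rw [hxval, hx0A d1 (Or.inl (hv1 ▸ hvA))]
    simp [hne13]
  have hxB : ∀ d : G.Dart, d.toProd.1 ∈ B → x ⟨d.edge, d.edge_mem⟩ = 0 := by
    intro d hd
    rw [hxval, hx0A d (Or.inl fun h => hAB _ h hd)]
    have hk : ∀ f : G.Dart, f.toProd.1 = v → f.toProd.2 ∈ A → d.edge ≠ f.edge := by
      intro f hf hfA
      rw [Ne, SimpleGraph.dart_edge_eq_iff]
      rintro (h | h)
      · rw [h, hf] at hd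
        exact hvB hd
      · rw [h] at hd
        exact hAB _ hfA hd
    simp [hk d1 hv1 h1A, hk d3 hv3 h3A]
  have hxsymm : ∀ d : G.Dart, x ⟨d.symm.edge, d.symm.edge_mem⟩ = x ⟨d.edge, d.edge_mem⟩ := by
    intro d
    congr 1
    exact Subtype.ext d.edge_symm
  have hx2 : x ⟨d2.edge, d2.edge_mem⟩ = 0 := by
    rw [← hxsymm]
    exact hxB _ h2B
  have hx4 : x ⟨d4.edge, d4.edge_mem⟩ = 0 := by
    rw [← hxsymm]
    exact hxB _ h4B
  have hrot : ∀ d e : G.Dart, d.toProd.1 ∈ B → d.toProd.1 = e.toProd.1 →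
      s (Quotient.mk _ e) = s (Quotient.mk _ d) := by
    intro d e hd hde
    refine const_of_sameCycle σ (fun d => s (Quotient.mk _ d)) (fun a => a.toProd.1 ∈ B)
        (fun a ha => ?_) (fun a ha => ?_) d e hd (hσ.rot.orbit_eq d e hde)
    · change (σ a).toProd.1 ∈ B
      rw [hσ.rot.fst_eq]
      exact ha
    · change s (Quotient.mk _ (σ a)) = s (Quotient.mk _ a)
      rw [hstep, hxB a ha, add_zero]
  have hpath : ∀ b, Relation.ReflTransGen (fun p q => G.Adj p q ∧ p ∈ B ∧ q ∈ B)
      d2.toProd.2 b → ∀ e : G.Dart, e.toProd.1 = b →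
      s (Quotient.mk _ e) = s (Quotient.mk _ d2.symm) := by
    intro b hb
    induction hb with
    | refl => exact fun e he => hrot d2.symm e h2B he.symm
    | @tail p q _ hpq ih =>
      intro e he
      obtain ⟨hadj, hp, hq⟩ := hpq
      let d : G.Dart := ⟨(p, q), hadj⟩
      rw [← ih d rfl]
      have h1 : s (Quotient.mk _ d.symm) = s (Quotient.mk _ d) := by
        rw [mk_symm, hstep, hxB d hp, add_zero]
      rw [← h1]
      exact hrot d.symm e hq he.symm
  have hfin := hpath _ hB d4.symm rfl
  rw [mk_symm, mk_symm, hstep, hstep, hx2, hx4, add_zero, add_zero] at hfin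
  have h5 := hstep d4
  have h6 := hstep d1
  rw [h41, hx4, add_zero] at h5
  rw [h12, hx1, h5] at h6
  rw [h6] at hfin
  exact one_ne_zero (left_eq_add.1 hfin)

/-- A partial coloring leaving a free color at `v` other than `k` contradicts the
counterexample property. -/
theorem free_color [Fintype V] (G : SimpleGraph V) (v : V)
    (hno : ¬ ∃ c : V → Fin 5, Proper5 G c ∧
      ∃ k : Fin 5, 6 * Nat.card {v : V | c v = k} ≤ Fintype.card V)
    (c : V → Fin 5) (hc : ∀ p q, p ≠ v → q ≠ v → G.Adj p q → c p ≠ c q) (k : Fin 5)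
    (hk : 6 * Nat.card {w : V | w ≠ v ∧ c w = k} ≤ Fintype.card V)
    (j : Fin 5) (hj : j ≠ k) : ∃ w, G.Adj v w ∧ c w = j := by
  classical
  by_contra hcon
  push Not at hcon
  apply hno
  refine ⟨Function.update c v j, ?_, k, ?_⟩
  · intro p q hpq
    by_cases hp : p = v
    · subst hp
      have : q ≠ p := hpq.ne'
      simp only [Function.update_self, Function.update_of_ne this]
      exact (hcon q hpq).symm
    · by_cases hq : q = v
      · subst hq
        simp only [Function.update_self, Function.update_of_ne hp]
        exact hcon p hpq.symm
      · rw [Function.update_of_ne hp, Function.update_of_ne hq]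
        exact hc p q hp hq hpq
  · have : {w : V | Function.update c v j w = k} = {w : V | w ≠ v ∧ c w = k} := by
      ext w
      by_cases hw : w = v
      · subst hw
        simp [hj]
      · simp [Function.update_of_ne hw, hw]
    rw [this]
    exact hk

/-- Kempe chain argument: if the neighbors of `v` have distinct colors avoiding `k`,
then any two of them are joined by a Kempe chain. -/
theorem kempe [Fintype V] (G : SimpleGraph V) (v : V)
    (hno : ¬ ∃ c : V → Fin 5, Proper5 G c ∧
      ∃ k : Fin 5, 6 * Nat.card {v : V | c v = k} ≤ Fintype.card V)
    (c : V → Fin 5) (hc : ∀ p q, p ≠ v → q ≠ v → G.Adj p q → c p ≠ c q) (k : Fin 5)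
    (hk : 6 * Nat.card {w : V | w ≠ v ∧ c w = k} ≤ Fintype.card V)
    (hinj : ∀ p q, G.Adj v p → G.Adj v q → c p = c q → p = q)
    (havoid : ∀ p, G.Adj v p → c p ≠ k) (a b : V) (ha : G.Adj v a) (hb : G.Adj v b) :
    Relation.ReflTransGen (fun p q => G.Adj p q ∧
      p ∈ {w | w ≠ v ∧ (c w = c a ∨ c w = c b)} ∧
      q ∈ {w | w ≠ v ∧ (c w = c a ∨ c w = c b)}) a b := by
  classical
  set S : Set V := {w | w ≠ v ∧ (c w = c a ∨ c w = c b)} with hS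
  set R : V → V → Prop := fun p q => G.Adj p q ∧ p ∈ S ∧ q ∈ S with hR
  by_contra hnot
  let X : Set V := {w | Relation.ReflTransGen R a w}
  have haS : a ∈ S := ⟨ha.ne', Or.inl rfl⟩
  have hXS : ∀ w ∈ X, w ∈ S := by
    intro w hw
    have hw' : Relation.ReflTransGen R a w := hw
    rcases Relation.ReflTransGen.cases_tail hw' with h | ⟨z, _, h⟩
    · rw [h]; exact haS
    · exact h.2.2
  let τ := Equiv.swap (c a) (c b)
  let c' : V → Fin 5 := fun w => if w ∈ X then τ (c w) else c w
  have hak := havoid a ha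
  have hbk := havoid b hb
  have hXout : ∀ p q, q ≠ v → p ∈ X → q ∉ X → G.Adj p q → c q ≠ c a ∧ c q ≠ c b := by
    intro p q hq hp hqX hpq
    by_contra hcon
    apply hqX
    have hqS : q ∈ S := ⟨hq, by tauto⟩
    exact Relation.ReflTransGen.tail hp ⟨hpq, hXS p hp, hqS⟩
  have hmix : ∀ p q, q ≠ v → p ∈ X → q ∉ X → G.Adj p q → τ (c p) ≠ c q := by
    intro p q hq hp hqX hpq
    obtain ⟨h1, h2⟩ := hXout p q hq hp hqX hpq
    rcases (hXS p hp).2 with h | h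
    · rw [h, Equiv.swap_apply_left]; exact h2.symm
    · rw [h, Equiv.swap_apply_right]; exact h1.symm
  have hc' : ∀ p q, p ≠ v → q ≠ v → G.Adj p q → c' p ≠ c' q := by
    intro p q hp hq hpq
    by_cases hpX : p ∈ X <;> by_cases hqX : q ∈ X <;> simp only [c', hpX, hqX, if_true, if_false]
    · exact fun h => hc p q hp hq hpq (τ.injective h)
    · exact hmix p q hq hpX hqX hpq
    · exact (hmix q p hp hqX hpX hpq.symm).symm
    · exact hc p q hp hq hpq
  have hck : {w : V | w ≠ v ∧ c' w = k} = {w : V | w ≠ v ∧ c w = k} := by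
    ext w
    simp only [Set.mem_ofPred_eq, c']
    by_cases hw : w ∈ X
    · simp only [hw, if_true]
      rcases (hXS w hw).2 with h | h
      · rw [h, Equiv.swap_apply_left]; tauto
      · rw [h, Equiv.swap_apply_right]; tauto
    · simp only [hw, if_false]
  obtain ⟨w, hvw, hw⟩ := free_color G v hno c' hc' k (by rw [hck]; exact hk) (c a) hak
  have hbX : b ∉ X := hnot
  have haX : a ∈ X := Relation.ReflTransGen.refl
  by_cases hwX : w ∈ X
  · have hw2 : τ (c w) = c a := by simpa only [c', hwX, if_true] using hw
    have hw3 : c w = c b := by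
      rw [← Equiv.swap_apply_right (c a) (c b)] at hw2
      exact (τ.injective (hw2.trans (by rfl)))
    exact hbX (hinj w b hvw hb hw3 ▸ hwX)
  · have hw2 : c w = c a := by simpa only [c', hwX, if_false] using hw
    exact hwX (hinj w a hvw ha hw2 ▸ haX)

/-- The four darts around a vertex of degree four, in cyclic order. -/
theorem four_cycle {α : Type*} [Fintype α] [DecidableEq α] (f : Equiv.Perm α) (a : α)
    (S : Finset α) (hS : ∀ b, b ∈ S ↔ f.SameCycle a b) (h4 : S.card = 4) :
    f (f (f (f a))) = a ∧ f (f a) ≠ a ∧ f (f (f a)) ≠ f a := by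
  have hne : f a ≠ a := by
    intro h
    have : S ⊆ {a} := by
      intro b hb
      obtain ⟨n, -, rfl⟩ := ((hS b).1 hb).exists_nat_pow_eq
      simp [Equiv.Perm.pow_apply_eq_self_of_apply_eq_self h]
    have := Finset.card_le_card this
    simp at this
    omega
  have hcyc := Equiv.Perm.isCycle_cycleOf f hne
  have hsupp : (f.cycleOf a).support = S := by
    ext b
    rw [hS, Equiv.Perm.mem_support_cycleOf_iff' hne]
  have hord : orderOf (f.cycleOf a) = 4 := by rw [hcyc.orderOf, hsupp, h4]
  have hpow : ∀ n : ℕ, (f ^ n) a = a ↔ 4 ∣ n := by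
    intro n
    rw [← Equiv.Perm.cycleOf_pow_apply_self, ← hord, orderOf_dvd_iff_pow_eq_one]
    constructor
    · intro h
      refine hcyc.pow_eq_one_iff.2 ⟨a, ?_, h⟩
      rwa [Equiv.Perm.cycleOf_apply_self]
    · intro h
      rw [h]; rfl
  have h2 : f (f a) ≠ a := fun h => by
    have := (hpow 2).1 h
    omega
  exact ⟨(hpow 4).2 dvd_rfl, h2, fun h => h2 (f.injective h)⟩

theorem statement8 [Fintype V] (G : SimpleGraph V) (σ : Equiv.Perm G.Dart)
    (hG : IsMinimalCounterexample G σ) :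
    ∀ v : V, 5 ≤ deg G v := by
  classical
  obtain ⟨hT, hno, hmin⟩ := hG
  intro v
  by_contra hdeg
  push Not at hdeg
  -- color `G - v`
  obtain ⟨c0, hc0, k, hk0⟩ := hmin {w : V // w ≠ v} (G.induce {w | w ≠ v})
    ⟨V, inferInstance, G, σ, hT, ⟨Subtype.val, fun h => h⟩, Subtype.val_injective⟩
    (Fintype.card_subtype_lt (x := v) (by simp))
  let c : V → Fin 5 := fun w => if h : w ≠ v then c0 ⟨w, h⟩ else k
  have hcval : ∀ w (h : w ≠ v), c w = c0 ⟨w, h⟩ := fun w h => dif_pos h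
  have hc : ∀ p q, p ≠ v → q ≠ v → G.Adj p q → c p ≠ c q := by
    intro p q hp hq hpq
    rw [hcval p hp, hcval q hq]
    exact hc0 (u := ⟨p, hp⟩) (w := ⟨q, hq⟩) hpq
  have hk : 6 * Nat.card {w : V | w ≠ v ∧ c w = k} ≤ Fintype.card V := by
    have h1 : Nat.card {w : V | w ≠ v ∧ c w = k} = Nat.card {w : {w : V // w ≠ v} | c0 w = k} := by
      refine Nat.card_congr ⟨fun w => ⟨⟨w.1, w.2.1⟩, ?_⟩, fun w => ⟨w.1.1, w.1.2, ?_⟩,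
        fun _ => rfl, fun _ => rfl⟩
      · have := w.2.2
        rwa [hcval _ w.2.1] at this
      · rw [hcval _ w.1.2]
        exact w.2
    rw [h1]
    exact hk0.trans (Fintype.card_subtype_le _)
  have hfree := free_color G v hno c hc k hk
  -- the neighbors together with `k` use all colors
  let N : Finset V := G.neighborFinset v
  have hNmem : ∀ w, w ∈ N ↔ G.Adj v w := fun w => G.mem_neighborFinset v w
  have hNcard : N.card = deg G v := by
    rw [deg, Nat.card_eq_fintype_card]
    exact G.card_neighborSet_eq_degree v |>.symm
  have hsub : (Finset.univ.erase k : Finset (Fin 5)) ⊆ N.image c := by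
    intro j hj
    obtain ⟨w, hw, hwj⟩ := hfree j (Finset.ne_of_mem_erase hj)
    exact Finset.mem_image.2 ⟨w, (hNmem w).2 hw, hwj⟩
  have h4 : (Finset.univ.erase k : Finset (Fin 5)).card = 4 := by
    rw [Finset.card_erase_of_mem (Finset.mem_univ k)]
    simp
  have hle := Finset.card_le_card hsub
  have himg : (N.image c).card ≤ N.card := Finset.card_image_le
  have hN4 : N.card = 4 := by omega
  have hinj0 : Set.InjOn c N := Finset.card_image_iff.1 (by omega)
  have hinj : ∀ p q, G.Adj v p → G.Adj v q → c p = c q → p = q := fun p q hp hq h =>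
    hinj0 (Finset.mem_coe.2 ((hNmem p).2 hp)) (Finset.mem_coe.2 ((hNmem q).2 hq)) h
  have heq : (Finset.univ.erase k : Finset (Fin 5)) = N.image c :=
    Finset.eq_of_subset_of_card_le hsub (by omega)
  have havoid : ∀ p, G.Adj v p → c p ≠ k := by
    intro p hp
    have : c p ∈ N.image c := Finset.mem_image_of_mem c ((hNmem p).2 hp)
    rw [← heq] at this
    exact Finset.ne_of_mem_erase this
  -- the four darts at `v`
  obtain ⟨u, hu⟩ : N.Nonempty := Finset.card_pos.1 (by omega)
  let d1 : G.Dart := ⟨(v, u), (hNmem u).1 hu⟩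
  let S : Finset G.Dart := Finset.univ.filter fun d => d.toProd.1 = v
  have hfst : ∀ e, σ.SameCycle d1 e → e.toProd.1 = v := by
    intro e he
    exact const_of_sameCycle σ (fun d => d.toProd.1) (fun _ => True) (fun _ _ => trivial)
      (fun a _ => hT.rot.fst_eq a) d1 e trivial he
  have hS : ∀ e, e ∈ S ↔ σ.SameCycle d1 e := by
    intro e
    simp only [S, Finset.mem_filter, Finset.mem_univ, true_and]
    exact ⟨fun h => hT.rot.orbit_eq d1 e h.symm, hfst e⟩
  have hScard : S.card = 4 := by
    have : (G.neighborFinset v).card = S.card := by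
      rw [SimpleGraph.card_neighborFinset_eq_degree]
      exact (G.dart_fst_fiber_card_eq_degree v).symm
    rw [← this]
    exact hN4
  obtain ⟨h41, h31, h42⟩ := four_cycle σ d1 S hS hScard
  obtain ⟨d2, h12⟩ : ∃ d, σ d1 = d := ⟨_, rfl⟩
  obtain ⟨d3, h23⟩ : ∃ d, σ d2 = d := ⟨_, rfl⟩
  obtain ⟨d4, h34⟩ : ∃ d, σ d3 = d := ⟨_, rfl⟩
  rw [h12, h23, h34] at h41
  rw [h12, h23] at h31
  rw [h12, h23, h34] at h42
  have hv1 : d1.toProd.1 = v := rfl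
  have hv2 : d2.toProd.1 = v := by rw [← h12, hT.rot.fst_eq]
  have hv3 : d3.toProd.1 = v := by rw [← h23, hT.rot.fst_eq, hv2]
  have hv4 : d4.toProd.1 = v := by rw [← h34, hT.rot.fst_eq, hv3]
  have hadj : ∀ d : G.Dart, d.toProd.1 = v → G.Adj v d.toProd.2 := fun d hd => hd ▸ d.adj
  have hdne : ∀ d e : G.Dart, d.toProd.1 = v → e.toProd.1 = v → d ≠ e →
      c d.toProd.2 ≠ c e.toProd.2 := by
    intro d e hd he hne h
    apply hne
    have := hinj _ _ (hadj d hd) (hadj e he) h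
    exact SimpleGraph.Dart.ext _ _ (Prod.ext (hd.trans he.symm) this)
  have h21 : d2 ≠ d1 := by
    intro h
    rw [h] at h12 h23
    exact h31 (h23.symm.trans h12)
  have h32 : d3 ≠ d2 := fun h => h21 (σ.injective (by rw [h12, h23, h]))
  have h43 : d4 ≠ d3 := fun h => h32 (σ.injective (by rw [h23, h34, h]))
  have h14 : d1 ≠ d4 := fun h => h43 (σ.injective (by rw [h34, h41, h]))
  have kA := kempe G v hno c hc k hk hinj havoid _ _ (hadj d1 hv1) (hadj d3 hv3)
  have kB := kempe G v hno c hc k hk hinj havoid _ _ (hadj d2 hv2) (hadj d4 hv4)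
  refine jordan_four G σ hT v d1 d2 d3 d4 hv1 h12 h23 h34 h41 h31.symm _ _ ?_ ?_ ?_
    ?_ ?_ ?_ ?_ kA kB
  · rintro w ⟨-, hw⟩ ⟨-, hw'⟩
    have e12 := hdne d2 d1 hv2 hv1 h21
    have e32 := hdne d3 d2 hv3 hv2 h32
    have e43 := hdne d4 d3 hv4 hv3 h43
    have e14 := hdne d1 d4 hv1 hv4 h14
    rcases hw with hw | hw <;> rcases hw' with hw' | hw' <;> rw [hw] at hw'
    · exact e12 hw'.symm
    · exact e14 hw'
    · exact e32 hw'
    · exact e43 hw'.symm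
  · exact fun h => h.1 rfl
  · exact fun h => h.1 rfl
  · exact ⟨(hadj d1 hv1).ne', Or.inl rfl⟩
  · exact ⟨(hadj d3 hv3).ne', Or.inr rfl⟩
  · exact ⟨(hadj d2 hv2).ne', Or.inl rfl⟩
  · exact ⟨(hadj d4 hv4).ne', Or.inr rfl⟩
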